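/- There exist absolute constants c1, c2 > 0 such that the following holds. Let 0 < δ < 1/4 and let x, y ∈ ℝ^n be two points on a common ray emanating from the origin (i.e., y = αx for some 0 ≤ α < 1) with ‖x‖₂ ≥ 4δ, ‖y‖₂ < ‖x‖₂, and ‖x−y‖₂ = 2δ. Let A : ℝ^n → ℝ^m be a standard gaussian matrix, let τ be uniformly distributed in [−λ,λ]^m independent of A, and let f(t) = sign(At+τ). If λ ≤ c1·‖x‖₂ and m ≥ c2·λ/δ, then with probability at least 0.9 one has | (√(2π)·λ/m)·d_H(f(x),f(y)) − ‖x−y‖₂ | > δ, i.e., f fails to be a δ-embedding of {x,y}. -/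

import Mathlib

open MeasureTheory ProbabilityTheory Real

noncomputable section

/-- Euclidean norm on `Fin n → ℝ`. -/
def enorm2 {n : ℕ} (x : Fin n → ℝ) : ℝ := Real.sqrt (∑ i, (x i)^2)

/-- Euclidean inner product. -/
def ip {n : ℕ} (x y : Fin n → ℝ) : ℝ := ∑ i, x i * y i

/-- sign function with values in {-1,1}. -/
def signPM (s : ℝ) : ℝ := if 0 ≤ s then 1 else -1

/-- componentwise sign. -/
def signVec {m : ℕ} (v : Fin m → ℝ) : Fin m → ℝ := fun i => signPM (v i)

/-- Hamming distance. -/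
def hamming {m : ℕ} (u v : Fin m → ℝ) : ℕ := (Finset.univ.filter fun i => u i ≠ v i).card

def mulVecR {m n : ℕ} (A : Fin m → Fin n → ℝ) (x : Fin n → ℝ) : Fin m → ℝ :=
  fun i => ∑ j, A i j * x j

def l1norm {m : ℕ} (v : Fin m → ℝ) : ℝ := ∑ i, |v i|

/-- the norm ‖v‖_{[s]}. -/
def knorm {m : ℕ} (s : ℕ) (v : Fin m → ℝ) : ℝ :=
  sSup {r | ∃ I : Finset (Fin m), I.card = s ∧ r = Real.sqrt (∑ i ∈ I, (v i)^2)}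

/-- standard gaussian measure on ℝ^n. -/
def gaussianPi (n : ℕ) : Measure (Fin n → ℝ) := Measure.pi fun _ => gaussianReal 0 1

instance (n : ℕ) : IsProbabilityMeasure (gaussianPi n) := by
  unfold gaussianPi; infer_instance

/-- standard gaussian m × n matrix distribution (rows). -/
def gaussianMatrix (m n : ℕ) : Measure (Fin m → Fin n → ℝ) := Measure.pi fun _ => gaussianPi n

instance (m n : ℕ) : IsProbabilityMeasure (gaussianMatrix m n) := by
  unfold gaussianMatrix; infer_instance

/-- uniform distribution on the cube [-λ,λ]^m. -/
def unifCube (m : ℕ) (lam : ℝ) : Measure (Fin m → ℝ) :=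
  (ENNReal.ofReal ((2*lam)^m))⁻¹ • volume.restrict (Set.univ.pi fun _ => Set.Icc (-lam) lam)

instance (m : ℕ) (lam : ℝ) : SFinite (unifCube m lam) := by
  unfold unifCube; infer_instance

/-- gaussian mean width. -/
def meanWidth {n : ℕ} (T : Set (Fin n → ℝ)) : ℝ :=
  ∫ g, sSup ((fun t => |ip g t|) '' T) ∂(gaussianPi n)

/-- Dvoretzky–Milman dimension. -/
def dstar {n : ℕ} (T : Set (Fin n → ℝ)) : ℝ :=
  (meanWidth T / sSup (enorm2 '' T))^2

/-- covering number. -/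
def coveringNumber {n : ℕ} (T : Set (Fin n → ℝ)) (θ : ℝ) : ℕ :=
  sInf {N : ℕ | ∃ F : Finset (Fin n → ℝ), F.card = N ∧ T ⊆ ⋃ c ∈ F, {x | enorm2 (x - c) < θ}}

/-- the difference set T - T. -/
def diffSet {n : ℕ} (T : Set (Fin n → ℝ)) : Set (Fin n → ℝ) :=
  {z | ∃ a ∈ T, ∃ b ∈ T, z = a - b}

/-- closed euclidean ball of radius r. -/
def ballE (n : ℕ) (r : ℝ) : Set (Fin n → ℝ) := {z | enorm2 z ≤ r}

theorem measurable_ip {n : ℕ} (x : Fin n → ℝ) : Measurable fun g : Fin n → ℝ => ip g x := by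
  unfold ip
  fun_prop

/-- The inner product of a standard gaussian vector with `x` is centred gaussian with
variance `‖x‖²`. -/
theorem gaussianPi_map_ip {n : ℕ} (x : Fin n → ℝ) :
    (gaussianPi n).map (fun g => ip g x) = gaussianReal 0 (∑ i, (x i) ^ 2).toNNReal := by
  have : IsProbabilityMeasure ((gaussianPi n).map (fun g => ip g x)) :=
    Measure.isProbabilityMeasure_map (measurable_ip x).aemeasurable
  apply Measure.ext_of_charFun
  ext t
  have hprod : ∀ g : Fin n → ℝ, Complex.exp (t * (ip g x : ℝ) * Complex.I) =
      ∏ j, Complex.exp ((t * x j : ℝ) * (g j : ℝ) * Complex.I) := by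
    intro g
    rw [← Complex.exp_sum]
    congr 1
    simp only [ip, Complex.ofReal_sum, Finset.mul_sum, Finset.sum_mul]
    refine Finset.sum_congr rfl fun j _ => ?_
    push_cast
    ring
  have hnonneg : 0 ≤ ∑ i, (x i) ^ 2 := Finset.sum_nonneg fun i _ => sq_nonneg _
  rw [charFun_apply_real, integral_map (measurable_ip x).aemeasurable (by fun_prop)]
  simp_rw [hprod]
  rw [gaussianPi, integral_fintype_prod_eq_prod
    (fun (j : Fin n) (s : ℝ) => Complex.exp ((t * x j : ℝ) * (s : ℝ) * Complex.I))]
  simp_rw [← charFun_apply_real, charFun_gaussianReal]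
  rw [← Complex.exp_sum, Real.coe_toNNReal _ hnonneg]
  congr 1
  push_cast
  simp only [Finset.sum_mul, mul_zero, zero_mul, zero_sub, Finset.sum_div,
    ← Finset.sum_neg_distrib]
  refine Finset.sum_congr rfl fun j _ => ?_
  ring

theorem gaussianReal_le_volume (μ : ℝ) {v : NNReal} (hv : v ≠ 0) (s : Set ℝ) :
    gaussianReal μ v s ≤ ENNReal.ofReal (√(2 * π * v))⁻¹ * volume s := by
  rw [gaussianReal_apply μ hv, ← setLIntegral_const]
  refine lintegral_mono fun a => ENNReal.ofReal_le_ofReal ?_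
  rw [gaussianPDFReal]
  refine mul_le_of_le_one_right (by positivity) (Real.exp_le_one_iff.2 ?_)
  exact div_nonpos_of_nonpos_of_nonneg (neg_nonpos.2 (sq_nonneg _)) (by positivity)

theorem signPM_ne_subset_uIcc {α : ℝ} (hα : 0 < α) (t : ℝ) :
    {s : ℝ | signPM (s + t) ≠ signPM (α * s + t)} ⊆ Set.uIcc (-t) (-t / α) := by
  intro s hs
  rw [Set.mem_uIcc, le_div_iff₀ hα, div_le_iff₀ hα]
  simp only [Set.mem_ofPred_eq, signPM] at hs
  split_ifs at hs with h1 h2 h2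
  · exact absurd rfl hs
  · left; constructor <;> nlinarith
  · right; constructor <;> nlinarith
  · exact absurd rfl hs

theorem enorm2_nonneg {n : ℕ} (x : Fin n → ℝ) : 0 ≤ enorm2 x := Real.sqrt_nonneg _

theorem enorm2_smul {n : ℕ} (c : ℝ) (x : Fin n → ℝ) : enorm2 (c • x) = |c| * enorm2 x := by
  simp only [enorm2, Pi.smul_apply, smul_eq_mul, mul_pow, ← Finset.mul_sum]
  rw [Real.sqrt_mul (sq_nonneg c), Real.sqrt_sq_eq_abs]

/-- Anti-concentration: a gaussian hyperplane with shift `t`, `|t| ≤ lam`, rarely separates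
`x` from `α • x`. -/
theorem gaussianPi_separates_le {n : ℕ} {x : Fin n → ℝ} (hx : 0 < enorm2 x) {α t lam : ℝ}
    (hα : 0 < α) (hα1 : α < 1) (ht : |t| ≤ lam) :
    gaussianPi n {g | signPM (ip g x + t) ≠ signPM (α * ip g x + t)} ≤
      ENNReal.ofReal (lam * (1 - α) / (α * (√(2 * π) * enorm2 x))) := by
  have hsum : 0 < ∑ i, (x i) ^ 2 := Real.sqrt_pos.1 hx
  have hv : (∑ i, (x i) ^ 2).toNNReal ≠ 0 := (Real.toNNReal_pos.2 hsum).ne'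
  have hpre : {g | signPM (ip g x + t) ≠ signPM (α * ip g x + t)} ⊆
      (fun g => ip g x) ⁻¹' Set.uIcc (-t) (-t / α) :=
    fun g hg => signPM_ne_subset_uIcc hα t hg
  calc gaussianPi n {g | signPM (ip g x + t) ≠ signPM (α * ip g x + t)}
      ≤ gaussianPi n ((fun g => ip g x) ⁻¹' Set.uIcc (-t) (-t / α)) := measure_mono hpre
    _ = gaussianReal 0 (∑ i, (x i) ^ 2).toNNReal (Set.uIcc (-t) (-t / α)) := by
        rw [← gaussianPi_map_ip, Measure.map_apply (measurable_ip x) measurableSet_uIcc]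
    _ ≤ ENNReal.ofReal (√(2 * π * (∑ i, (x i) ^ 2).toNNReal))⁻¹ *
          volume (Set.uIcc (-t) (-t / α)) := gaussianReal_le_volume 0 hv _
    _ ≤ _ := by
        rw [Real.volume_interval, ← ENNReal.ofReal_mul (by positivity),
          Real.coe_toNNReal _ hsum.le, Real.sqrt_mul (by positivity)]
        refine ENNReal.ofReal_le_ofReal ?_
        have hlen : |-t / α - -t| = |t| * ((1 - α) / α) := by
          have : -t / α - -t = -(t * ((1 - α) / α)) := by field_simp; ring
          rw [this, abs_neg, abs_mul, abs_of_pos (div_pos (sub_pos.2 hα1) hα)]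
        rw [hlen]
        have hle : |t| * ((1 - α) / α) ≤ lam * ((1 - α) / α) :=
          mul_le_mul_of_nonneg_right ht (div_pos (sub_pos.2 hα1) hα).le
        calc (√(2 * π) * enorm2 x)⁻¹ * (|t| * ((1 - α) / α))
            ≤ (√(2 * π) * enorm2 x)⁻¹ * (lam * ((1 - α) / α)) :=
              mul_le_mul_of_nonneg_left hle (by positivity)
          _ = _ := by field_simp

theorem isProbabilityMeasure_unifCube (m : ℕ) {lam : ℝ} (hlam : 0 < lam) :
    IsProbabilityMeasure (unifCube m lam) := by
  constructor
  have hvol : volume (Set.univ.pi fun _ : Fin m => Set.Icc (-lam) lam) =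
      ENNReal.ofReal ((2 * lam) ^ m) := by
    rw [volume_pi_pi]
    simp only [Real.volume_Icc, Finset.prod_const, Finset.card_univ, Fintype.card_fin]
    rw [ENNReal.ofReal_pow (by positivity)]
    congr 2
    ring
  rw [unifCube, Measure.smul_apply, Measure.restrict_apply_univ, hvol, smul_eq_mul]
  exact ENNReal.inv_mul_cancel (ENNReal.ofReal_pos.2 (by positivity)).ne' ENNReal.ofReal_ne_top

theorem ae_unifCube_abs_le (m : ℕ) (lam : ℝ) :
    ∀ᵐ τ ∂(unifCube m lam), ∀ i, |τ i| ≤ lam := by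
  refine Measure.ae_smul_measure ?_ _
  filter_upwards [ae_restrict_mem
    (MeasurableSet.univ_pi fun _ : Fin m => measurableSet_Icc)] with τ hτ i
  exact abs_le.2 (hτ i (Set.mem_univ i))

theorem measurable_signPM : Measurable signPM :=
  Measurable.ite measurableSet_Ici measurable_const measurable_const

theorem measurableSet_separates {m n : ℕ} (x : Fin n → ℝ) (α : ℝ) (i : Fin m) :
    MeasurableSet {p : (Fin m → Fin n → ℝ) × (Fin m → ℝ) |
      signPM (ip (p.1 i) x + p.2 i) ≠ signPM (α * ip (p.1 i) x + p.2 i)} := by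
  have hip : Measurable fun p : (Fin m → Fin n → ℝ) × (Fin m → ℝ) => ip (p.1 i) x :=
    (measurable_ip x).comp ((measurable_pi_apply i).comp measurable_fst)
  have hτ : Measurable fun p : (Fin m → Fin n → ℝ) × (Fin m → ℝ) => p.2 i :=
    (measurable_pi_apply i).comp measurable_snd
  exact (measurableSet_eq_fun (measurable_signPM.comp (hip.add hτ))
    (measurable_signPM.comp ((hip.const_mul α).add hτ))).compl

theorem prod_separates_le {m n : ℕ} {x : Fin n → ℝ} (hx : 0 < enorm2 x) {α lam : ℝ}
    (hα : 0 < α) (hα1 : α < 1) (hlam : 0 < lam) (i : Fin m) :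
    ((gaussianMatrix m n).prod (unifCube m lam))
      {p | signPM (ip (p.1 i) x + p.2 i) ≠ signPM (α * ip (p.1 i) x + p.2 i)} ≤
      ENNReal.ofReal (lam * (1 - α) / (α * (√(2 * π) * enorm2 x))) := by
  have := isProbabilityMeasure_unifCube m hlam
  rw [Measure.prod_apply_symm (measurableSet_separates x α i)]
  set B := ENNReal.ofReal (lam * (1 - α) / (α * (√(2 * π) * enorm2 x)))
  calc _ ≤ ∫⁻ _, B ∂(unifCube m lam) := by
        refine lintegral_mono_ae ?_
        filter_upwards [ae_unifCube_abs_le m lam] with τ hτ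
        have hmp : MeasurePreserving (Function.eval i) (gaussianMatrix m n) (gaussianPi n) :=
          measurePreserving_eval (fun _ : Fin m => gaussianPi n) i
        have hmeas : MeasurableSet
            {g : Fin n → ℝ | signPM (ip g x + τ i) ≠ signPM (α * ip g x + τ i)} :=
          (measurableSet_eq_fun (measurable_signPM.comp ((measurable_ip x).add_const _))
            (measurable_signPM.comp (((measurable_ip x).const_mul α).add_const _))).compl
        refine le_trans (le_of_eq ?_) (gaussianPi_separates_le hx hα hα1 (hτ i))
        rw [← hmp.measure_preimage hmeas.nullMeasurableSet]
        rfl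
    _ = B := by simp

/-- The Hamming distance counts the hyperplanes that separate `x` from `α • x`. -/
theorem hamming_eq_sum_indicator {m n : ℕ} (x : Fin n → ℝ) (α : ℝ)
    (p : (Fin m → Fin n → ℝ) × (Fin m → ℝ)) :
    (hamming (signVec (mulVecR p.1 x + p.2)) (signVec (mulVecR p.1 (α • x) + p.2)) : ENNReal) =
      ∑ i, Set.indicator {p : (Fin m → Fin n → ℝ) × (Fin m → ℝ) |
        signPM (ip (p.1 i) x + p.2 i) ≠ signPM (α * ip (p.1 i) x + p.2 i)} 1 p := by
  have hscale : ∀ i, mulVecR p.1 (α • x) i = α * ip (p.1 i) x := by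
    intro i
    simp only [mulVecR, ip, Pi.smul_apply, smul_eq_mul, Finset.mul_sum]
    exact Finset.sum_congr rfl fun j _ => by ring
  simp only [hamming, signVec, Pi.add_apply, hscale, Finset.card_filter, Set.indicator_apply,
    Set.mem_ofPred_eq, Pi.one_apply]
  push_cast
  rfl

theorem measurable_hamming {m n : ℕ} (x : Fin n → ℝ) (α : ℝ) :
    Measurable fun p : (Fin m → Fin n → ℝ) × (Fin m → ℝ) =>
      (hamming (signVec (mulVecR p.1 x + p.2)) (signVec (mulVecR p.1 (α • x) + p.2)) :
        ENNReal) := by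
  simp_rw [hamming_eq_sum_indicator]
  exact Finset.measurable_fun_sum _
    fun i _ => measurable_one.indicator (measurableSet_separates x α i)

theorem lintegral_hamming_le {m n : ℕ} {x : Fin n → ℝ} (hx : 0 < enorm2 x) {α lam : ℝ}
    (hα : 0 < α) (hα1 : α < 1) (hlam : 0 < lam) :
    (∫⁻ p, (hamming (signVec (mulVecR p.1 x + p.2)) (signVec (mulVecR p.1 (α • x) + p.2)) :
        ENNReal) ∂((gaussianMatrix m n).prod (unifCube m lam))) ≤
      m * ENNReal.ofReal (lam * (1 - α) / (α * (√(2 * π) * enorm2 x))) := by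
  simp_rw [hamming_eq_sum_indicator]
  rw [lintegral_finsetSum _
    fun i _ => measurable_one.indicator (measurableSet_separates x α i)]
  simp_rw [lintegral_indicator_one (measurableSet_separates x α _)]
  calc _ ≤ ∑ _i : Fin m, ENNReal.ofReal (lam * (1 - α) / (α * (√(2 * π) * enorm2 x))) :=
        Finset.sum_le_sum fun i _ => prod_separates_le hx hα hα1 hlam i
    _ = _ := by simp

/-- Lemma B.1: minimal shift — f fails to be a δ-embedding of two points on a ray if the
shift parameter λ is too small. -/
theorem min_shift_failure :
    ∃ c1 c2 : ℝ, 0 < c1 ∧ 0 < c2 ∧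
      ∀ (n m : ℕ) (δ lam α : ℝ) (x y : Fin n → ℝ),
        0 < δ → δ < 1/4 →
        0 ≤ α → α < 1 → y = α • x →
        enorm2 x ≥ 4 * δ → enorm2 y < enorm2 x → enorm2 (x - y) = 2 * δ →
        0 < lam → lam ≤ c1 * enorm2 x → (m : ℝ) ≥ c2 * lam / δ →
        ENNReal.ofReal 0.9 ≤
          ((gaussianMatrix m n).prod (unifCube m lam))
            {p | |Real.sqrt (2 * Real.pi) * lam / m *
                    (hamming (signVec (mulVecR p.1 x + p.2)) (signVec (mulVecR p.1 y + p.2)) : ℝ)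
                  - enorm2 (x - y)| > δ} := by
  refine ⟨1 / 10, 1, by norm_num, one_pos, ?_⟩
  rintro n m δ lam α x y hδ - - hα1 rfl hx - hxy hlam hlam' hm
  have hR : 0 < enorm2 x := by linarith
  have hmpos : (0 : ℝ) < m := lt_of_lt_of_le (by positivity) hm
  have hdist : (1 - α) * enorm2 x = 2 * δ := by
    rw [← hxy, ← abs_of_pos (sub_pos.2 hα1), ← enorm2_smul, sub_smul, one_smul]
  have hα : 1 / 2 ≤ α := by nlinarith
  have := isProbabilityMeasure_unifCube m hlam
  rw [hxy]
  set P := (gaussianMatrix m n).prod (unifCube m lam)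
  set H : (Fin m → Fin n → ℝ) × (Fin m → ℝ) → ℕ := fun p =>
    hamming (signVec (mulVecR p.1 x + p.2)) (signVec (mulVecR p.1 (α • x) + p.2)) with hH
  set θ : ℝ := δ * m / (√(2 * π) * lam) with hθ
  have hθpos : 0 < θ := by positivity
  set S := {p | |√(2 * π) * lam / m * (H p : ℝ) - 2 * δ| > δ} with hS
  have hbad : P Sᶜ ≤ ENNReal.ofReal 0.1 := by
    have hsub : Sᶜ ⊆ {p | ENNReal.ofReal θ ≤ (H p : ENNReal)} := by
      intro p hp
      simp only [hS, Set.mem_compl_iff, Set.mem_ofPred_eq, not_lt, gt_iff_lt] at hp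
      have hlow : δ ≤ √(2 * π) * lam / m * (H p : ℝ) := by linarith [(abs_le.1 hp).1]
      rw [Set.mem_ofPred_eq, ← ENNReal.ofReal_natCast]
      refine ENNReal.ofReal_le_ofReal ?_
      rw [hθ, div_le_iff₀ (by positivity)]
      rw [div_mul_eq_mul_div, le_div_iff₀ hmpos] at hlow
      linarith
    have hmarkov : P Sᶜ ≤ (∫⁻ p, (H p : ENNReal) ∂P) / ENNReal.ofReal θ :=
      (measure_mono hsub).trans (meas_ge_le_lintegral_div (measurable_hamming x α).aemeasurable
        (by simpa using hθpos) ENNReal.ofReal_ne_top)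
    refine hmarkov.trans ?_
    refine (ENNReal.div_le_div_right
      (lintegral_hamming_le hR (by linarith) hα1 hlam) _).trans ?_
    rw [← ENNReal.ofReal_natCast, ← ENNReal.ofReal_mul hmpos.le,
      ← ENNReal.ofReal_div_of_pos hθpos]
    refine ENNReal.ofReal_le_ofReal ?_
    have h1α : 1 - α = 2 * δ / enorm2 x := by rw [← hdist]; field_simp
    have hval : m * (lam * (1 - α) / (α * (√(2 * π) * enorm2 x))) / θ =
        (lam / enorm2 x) ^ 2 * (2 / α) := by
      rw [h1α, hθ]
      field_simp
    have hratio : lam / enorm2 x ≤ 1 / 10 := by rwa [div_le_iff₀ hR]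
    have hα4 : 2 / α ≤ 4 := by rw [div_le_iff₀ (by linarith)]; linarith
    rw [hval]
    calc (lam / enorm2 x) ^ 2 * (2 / α) ≤ (1 / 10) ^ 2 * 4 := by gcongr
      _ ≤ 0.1 := by norm_num
  have htotal : (1 : ENNReal) ≤ P S + P Sᶜ := by
    rw [← measure_univ (μ := P), ← Set.union_compl_self S]
    exact measure_union_le _ _
  have hsplit : ENNReal.ofReal 0.9 + ENNReal.ofReal 0.1 = 1 := by
    rw [← ENNReal.ofReal_add (by norm_num) (by norm_num)]
    norm_num
  refine (ENNReal.add_le_add_iff_right (ENNReal.ofReal_ne_top (r := 0.1))).1 ?_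
  rw [hsplit]
  exact htotal.trans (by gcongr)

end
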